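/- Let Ω ⊆ ℂ be open and let p : Ω → Matrix n n ℂ be smooth with p² = p, pᴴ = p and (1 − p) ∂_z̄ p = 0 at every point of Ω (a holomorphic Hermitian projection-valued map). Then h := 2p − I satisfies hᴴ h = I, h² = I, and the harmonic map equation ∂_z(h⁻¹ ∂_z̄ h) + ∂_z̄(h⁻¹ ∂_z h) = 0 on Ω. -/

import Mathlib

open Complex Matrix

noncomputable section

/-- Wirtinger derivative `∂_z` of a ℂ-valued function of one complex variable,
viewed as a function of two real variables:  `∂_z F = ½(∂_x F − i ∂_y F)`. -/
def wdz (f : ℂ → ℂ) (z : ℂ) : ℂ :=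
  (1 / 2 : ℂ) * (fderiv ℝ f z 1 - Complex.I * fderiv ℝ f z Complex.I)

/-- Wirtinger derivative `∂_z̄ F = ½(∂_x F + i ∂_y F)`. -/
def wdzbar (f : ℂ → ℂ) (z : ℂ) : ℂ :=
  (1 / 2 : ℂ) * (fderiv ℝ f z 1 + Complex.I * fderiv ℝ f z Complex.I)

/-- Entrywise Wirtinger derivative `∂_z` for matrix-valued functions. -/
def mdz {n m : Type*} (F : ℂ → Matrix n m ℂ) (z : ℂ) : Matrix n m ℂ :=
  Matrix.of fun i j => wdz (fun w => F w i j) z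

/-- Entrywise Wirtinger derivative `∂_z̄` for matrix-valued functions. -/
def mdzbar {n m : Type*} (F : ℂ → Matrix n m ℂ) (z : ℂ) : Matrix n m ℂ :=
  Matrix.of fun i j => wdzbar (fun w => F w i j) z

/-- A matrix-valued function is smooth on a set if each entry is `C^∞`
as a function of the two real variables. -/
def MSmoothOn {n m : Type*} (F : ℂ → Matrix n m ℂ) (Ω : Set ℂ) : Prop :=
  ∀ i j, ContDiffOn ℝ (⊤ : ℕ∞) (fun z => F z i j) Ω

theorem aux_conj (f : ℂ → ℂ) (z : ℂ) (hf : DifferentiableAt ℝ f z) :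
    wdz (fun w => star (f w)) z = star (wdzbar f z) := by
  have h1 : HasFDerivAt (fun w => star (f w))
      ((Complex.conjCLE : ℂ →L[ℝ] ℂ).comp (fderiv ℝ f z)) z :=
    (Complex.conjCLE : ℂ →L[ℝ] ℂ).hasFDerivAt.comp z hf.hasFDerivAt
  unfold wdz wdzbar
  rw [h1.fderiv]
  simp
  ring

theorem aux_comm (f : ℂ → ℂ) (z : ℂ) (hf : ContDiffAt ℝ (⊤ : ℕ∞) f z) :
    wdz (wdzbar f) z = wdzbar (wdz f) z := by
  have hs : IsSymmSndFDerivAt ℝ f z := by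
    apply hf.isSymmSndFDerivAt
    simp only [minSmoothness_of_isRCLikeNormedField]
    exact WithTop.coe_le_coe.2 (le_top : (2 : ℕ∞) ≤ ⊤)
  have hd : DifferentiableAt ℝ (fderiv ℝ f) z :=
    (hf.fderiv_right (m := 1) (by norm_cast)).differentiableAt (by norm_num)
  have e : ∀ v : ℂ, HasFDerivAt (fun w => fderiv ℝ f w v)
      ((fderiv ℝ (fderiv ℝ f) z).flip v) z := by
    intro v
    have := hd.hasFDerivAt.clm_apply (hasFDerivAt_const v z)
    simpa using this
  have e1 : HasFDerivAt (wdzbar f) _ z := ((e 1).add ((e I).const_mul I)).const_mul (1/2)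
  have e2 : HasFDerivAt (wdz f) _ z := ((e 1).sub ((e I).const_mul I)).const_mul (1/2)
  have := hs.eq 1 I
  rw [wdz, wdzbar, e1.fderiv, e2.fderiv]
  simp [this]
  ring

theorem aux_mul (n : Type*) [Fintype n] (p q : ℂ → Matrix n n ℂ) (z : ℂ)
    (hp : ∀ i j, DifferentiableAt ℝ (fun w => p w i j) z)
    (hq : ∀ i j, DifferentiableAt ℝ (fun w => q w i j) z) :
    mdz (fun w => p w * q w) z = mdz p z * q z + p z * mdz q z := by
  ext i j
  have e : HasFDerivAt (fun w => (p w * q w) i j) _ z :=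
    HasFDerivAt.fun_sum (u := Finset.univ) fun k _ => (hp i k).hasFDerivAt.mul (hq k j).hasFDerivAt
  simp only [mdz, Matrix.add_apply, Matrix.mul_apply, Matrix.of_apply, wdz]
  simp only [Matrix.mul_apply] at e
  rw [e.fderiv]
  simp only [_root_.sum_apply, _root_.add_apply, _root_.smul_apply,
    smul_eq_mul, Finset.mul_sum, ← Finset.sum_sub_distrib,
    ← Finset.sum_add_distrib]
  refine Finset.sum_congr rfl fun k _ => ?_
  ring

theorem aux_wdz_congr {f g : ℂ → ℂ} {z : ℂ} (hfg : f =ᶠ[nhds z] g) : wdz f z = wdz g z := by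
  simp only [wdz, hfg.fderiv_eq]

theorem aux_wdzbar_congr {f g : ℂ → ℂ} {z : ℂ} (hfg : f =ᶠ[nhds z] g) :
    wdzbar f z = wdzbar g z := by
  simp only [wdzbar, hfg.fderiv_eq]

theorem aux_wdz_lin (f : ℂ → ℂ) (c d : ℂ) (z : ℂ) :
    wdz (fun w => c * f w - d) z = c * wdz f z := by
  simp only [wdz, fderiv_sub_const]
  have : fderiv ℝ (fun w => c * f w) z = c • fderiv ℝ f z := congrFun (fderiv_const_smul_field (𝕜 := ℝ) (f := f) c) z
  rw [this]
  simp
  ring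

theorem aux_wdzbar_lin (f : ℂ → ℂ) (c d : ℂ) (z : ℂ) :
    wdzbar (fun w => c * f w - d) z = c * wdzbar f z := by
  simp only [wdzbar, fderiv_sub_const]
  have : fderiv ℝ (fun w => c * f w) z = c • fderiv ℝ f z := congrFun (fderiv_const_smul_field (𝕜 := ℝ) (f := f) c) z
  rw [this]
  simp
  ring

/-- if `p` is a smooth holomorphic Hermitian projection-valued map
(`p² = p`, `pᴴ = p`, `(1−p)∂_z̄p = 0` on `Ω`), then `h := 2p − I` satisfies
`hᴴh = I`, `h² = I` and the harmonic map equation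
`∂_z(h⁻¹∂_z̄h) + ∂_z̄(h⁻¹∂_zh) = 0` on `Ω`. -/
theorem stmt10 {n : Type*} [Fintype n] [DecidableEq n]
    (Ω : Set ℂ) (hΩ : IsOpen Ω) (p : ℂ → Matrix n n ℂ)
    (hsm : MSmoothOn p Ω)
    (hproj : ∀ z ∈ Ω, p z * p z = p z)
    (hherm : ∀ z ∈ Ω, (p z)ᴴ = p z)
    (hhol : ∀ z ∈ Ω, (1 - p z) * mdzbar p z = 0)
    (h : ℂ → Matrix n n ℂ)
    (hh : ∀ z, h z = (2 : ℂ) • p z - 1) :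
    ∀ z ∈ Ω,
      (h z)ᴴ * h z = 1 ∧ h z * h z = 1
        ∧ mdz (fun w => (h w)⁻¹ * mdzbar h w) z
            + mdzbar (fun w => (h w)⁻¹ * mdz h w) z = 0 := by
  have hsq : ∀ z ∈ Ω, h z * h z = 1 := by
    intro z hz
    rw [hh]
    simp only [sub_mul, mul_sub, smul_mul_assoc, mul_smul_comm, hproj z hz, mul_one, one_mul]
    module
  have hinv : ∀ z ∈ Ω, (h z)⁻¹ = h z := fun z hz => Matrix.inv_eq_right_inv (hsq z hz)
  have hsmA : ∀ z ∈ Ω, ∀ i j, ContDiffAt ℝ (⊤ : ℕ∞) (fun w => p w i j) z :=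
    fun z hz i j => (hsm i j).contDiffAt (hΩ.mem_nhds hz)
  have hdiff : ∀ z ∈ Ω, ∀ i j, DifferentiableAt ℝ (fun w => p w i j) z :=
    fun z hz i j => (hsmA z hz i j).differentiableAt (by simp)
  have hdz : ∀ z, mdz h z = (2 : ℂ) • mdz p z := by
    intro z
    ext i j
    simp only [mdz, hh, Matrix.of_apply, Matrix.smul_apply, Matrix.sub_apply, smul_eq_mul]
    exact aux_wdz_lin _ _ _ _
  have hdzb : ∀ z, mdzbar h z = (2 : ℂ) • mdzbar p z := by
    intro z
    ext i j
    simp only [mdzbar, hh, Matrix.of_apply, Matrix.smul_apply, Matrix.sub_apply, smul_eq_mul]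
    exact aux_wdzbar_lin _ _ _ _
  have k1 : ∀ z ∈ Ω, p z * mdzbar p z = mdzbar p z := by
    intro z hz
    have := hhol z hz
    rw [sub_mul, one_mul, sub_eq_zero] at this
    exact this.symm
  have hadj : ∀ z ∈ Ω, (mdzbar p z)ᴴ = mdz p z := by
    intro z hz
    ext i j
    simp only [mdz, mdzbar, Matrix.of_apply, Matrix.conjTranspose_apply]
    rw [← aux_conj _ _ (hdiff z hz j i)]
    apply aux_wdz_congr
    filter_upwards [hΩ.mem_nhds hz] with w hw
    conv_rhs => rw [← hherm w hw]
    rfl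
  have k2 : ∀ z ∈ Ω, p z * mdz p z = 0 := by
    intro z hz
    have h1 : mdz p z * p z = mdz p z := by
      have := congrArg Matrix.conjTranspose (k1 z hz)
      rwa [Matrix.conjTranspose_mul, hadj z hz, hherm z hz] at this
    have h2 : mdz (fun w => p w * p w) z = mdz p z := by
      ext i j
      apply aux_wdz_congr
      filter_upwards [hΩ.mem_nhds hz] with w hw
      rw [hproj w hw]
    rw [aux_mul n p p z (hdiff z hz) (hdiff z hz), h1] at h2
    simpa using h2
  intro z hz
  refine ⟨?_, hsq z hz, ?_⟩
  · have : (h z)ᴴ = h z := by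
      rw [hh]
      simp [hherm z hz]
    rw [this, hsq z hz]
  · ext i j
    have a1 : wdz (fun w => ((h w)⁻¹ * mdzbar h w) i j) z
        = 2 * wdz (wdzbar (fun w => p w i j)) z := by
      rw [← aux_wdz_lin _ 2 0]
      apply aux_wdz_congr
      filter_upwards [hΩ.mem_nhds hz] with w hw
      have : (h w)⁻¹ * mdzbar h w = (2 : ℂ) • mdzbar p w := by
        rw [hinv w hw, hdzb, hh]
        simp only [sub_mul, smul_mul_assoc, mul_smul_comm, k1 w hw, one_mul]
        module
      rw [this]
      simp [mdzbar]
    have a2 : wdzbar (fun w => ((h w)⁻¹ * mdz h w) i j) z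
        = (-2) * wdzbar (wdz (fun w => p w i j)) z := by
      rw [← aux_wdzbar_lin _ (-2) 0]
      apply aux_wdzbar_congr
      filter_upwards [hΩ.mem_nhds hz] with w hw
      have : (h w)⁻¹ * mdz h w = (-2 : ℂ) • mdz p w := by
        rw [hinv w hw, hdz, hh]
        simp only [sub_mul, smul_mul_assoc, mul_smul_comm, k2 w hw, one_mul]
        module
      rw [this]
      simp [mdz]
    change wdz (fun w => ((h w)⁻¹ * mdzbar h w) i j) z
      + wdzbar (fun w => ((h w)⁻¹ * mdz h w) i j) z = 0
    rw [a1, a2, aux_comm _ _ (hsmA z hz i j)]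
    ring
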